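/- Existence: The truthful profile (s^t,…,s^t) is an equilibrium of the competitive protocol F^c if and only if no agent is fanatic. -/

import Mathlib

open scoped Classical
noncomputable section

/-- A strategy of an agent: `(p, q)` with `p = P(mᵢ = 0 ∣ bᵢ = 0)`, `q = P(mᵢ = 0 ∣ bᵢ = 1)`. -/
abbrev Strategy : Type := (Set.Icc (0:ℝ) 1) × (Set.Icc (0:ℝ) 1)

/-- The truthful strategy `sᵗ = (1,0)`. -/
def sT : Strategy := (⟨1, by norm_num⟩, ⟨0, by norm_num⟩)

/-- A zero-information strategy: `p = q`. -/
def ZeroInfo (s : Strategy) : Prop := (s.1 : ℝ) = (s.2 : ℝ)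

/-- Vectors of `N+1` bits (bits of the center and the `N` agents; also used for
message vectors and for the center's replies).  Coordinate `0` is the center. -/
abbrev Bits (N : ℕ) : Type := Fin (N+1) → Bool

/-- A strategy profile of the `N` agents. -/
abbrev Profile (N : ℕ) : Type := Fin N → Strategy

/-- A protocol for a single agent: a map from strategy profiles and message vectors to
distributions over replies `f ∈ {0,1}^{N+1}`. -/
abbrev Protocol (N : ℕ) : Type := Profile N → Bits N → PMF (Bits N)

/-- `P(message = msg ∣ bit = bit)` under strategy `s` (where `false` plays the role of `0`). -/
def strandP (s : Strategy) (bit msg : Bool) : ℝ :=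
  if msg then 1 - (if bit then (s.2 : ℝ) else (s.1 : ℝ))
  else (if bit then (s.2 : ℝ) else (s.1 : ℝ))

/-- `P(messages = m ∣ bits = b)` under profile `s`; the center's message is her own bit. -/
def msgP {N : ℕ} (s : Profile N) (b m : Bits N) : ℝ :=
  (if m 0 = b 0 then (1:ℝ) else 0) * ∏ i : Fin N, strandP (s i) (b i.succ) (m i.succ)

/-- Joint probability of bits `b`, messages `m` and reply `f` (to the relevant agent),
under profile `s` and protocol `F`; bits are i.i.d. uniform. -/
def jointP {N : ℕ} (s : Profile N) (F : Protocol N) (b m f : Bits N) : ℝ :=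
  ((1:ℝ)/2)^(N+1) * msgP s b m * ((F s m) f).toReal

/-- `P(bᵢ = bi, mᵢ = mi, fᵢ = f, g(b) = val)` for agent `i` (coordinate `i.succ`). -/
def pObs {N : ℕ} (g : Bits N → Bool) (s : Profile N) (F : Protocol N) (i : Fin N)
    (bi mi : Bool) (f : Bits N) (val : Bool) : ℝ :=
  ∑ b : Bits N, ∑ m : Bits N,
    if b i.succ = bi ∧ m i.succ = mi ∧ g b = val then jointP s F b m f else 0

/-- `P(bᵢ = bi, mᵢ = mi, fᵢ = f)` for agent `i`. -/
def pObsAll {N : ℕ} (s : Profile N) (F : Protocol N) (i : Fin N)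
    (bi mi : Bool) (f : Bits N) : ℝ :=
  ∑ b : Bits N, ∑ m : Bits N,
    if b i.succ = bi ∧ m i.succ = mi then jointP s F b m f else 0

/-- `P(b_k = 1, bᵢ = bi, mᵢ = mi, fᵢ = f)` for agent `i`. -/
def pBit {N : ℕ} (s : Profile N) (F : Protocol N) (i : Fin N)
    (bi mi : Bool) (f : Bits N) (k : Fin (N+1)) : ℝ :=
  ∑ b : Bits N, ∑ m : Bits N,
    if b i.succ = bi ∧ m i.succ = mi ∧ b k = true then jointP s F b m f else 0

/-- The posterior `v_k = P(b_k = 1 ∣ fᵢ, mᵢ, bᵢ)` of agent `i` at the realization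
`(bi, mi, f)`. -/
def post {N : ℕ} (s : Profile N) (F : Protocol N) (i : Fin N)
    (bi mi : Bool) (f : Bits N) (k : Fin (N+1)) : ℝ :=
  pBit s F i bi mi f k / pObsAll s F i bi mi f

/-- Expected profit `V_i(s⃗; F_i)`: after observing `(bᵢ, mᵢ, fᵢ)` the agent guesses the
more likely value of `g(b)` (uniformly at random in case of a tie) and earns `c i` iff
the guess is correct. -/
def V {N : ℕ} (g : Bits N → Bool) (c : Fin N → ℝ) (s : Profile N) (F : Protocol N)
    (i : Fin N) : ℝ :=
  c i * ∑ bi : Bool, ∑ mi : Bool, ∑ f : Bits N,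
    (if pObs g s F i bi mi f true > pObs g s F i bi mi f false then pObs g s F i bi mi f true
     else if pObs g s F i bi mi f false > pObs g s F i bi mi f true then
       pObs g s F i bi mi f false
     else (pObs g s F i bi mi f false + pObs g s F i bi mi f true) / 2)

/-- Utility `U_i(s⃗; F_i) = V_i(s⃗; F_i) − priceᵢ(sᵢ)`. -/
def U {N : ℕ} (g : Bits N → Bool) (c : Fin N → ℝ) (price : Fin N → Strategy → ℝ)
    (s : Profile N) (F : Protocol N) (i : Fin N) : ℝ :=
  V g c s F i - price i (s i)

/-- The all-truthful profile `(sᵗ, …, sᵗ)`. -/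
def truthProfile (N : ℕ) : Profile N := fun _ => sT

/-- `s⃗` is an equilibrium of the protocol `F = (F_1,…,F_N)`. -/
def Equilibrium {N : ℕ} (g : Bits N → Bool) (c : Fin N → ℝ) (price : Fin N → Strategy → ℝ)
    (s : Profile N) (FF : Fin N → Protocol N) : Prop :=
  ∀ i : Fin N, ∀ s' : Strategy,
    U g c price s (FF i) i ≥ U g c price (Function.update s i s') (FF i) i

/-- The improvement `F_i⁺` of a protocol `F_i`: it agrees with `F_i` when `s_i` is a
zero-information strategy, and otherwise returns the reply whose first coordinate is
`m₀ = b₀` and whose remaining coordinates are those of `F_i`'s reply. -/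
def improve {N : ℕ} (i : Fin N) (F : Protocol N) : Protocol N := fun s m =>
  if ZeroInfo (s i) then F s m
  else PMF.map (fun f => Function.update f 0 (m 0)) (F s m)

/-- The center is helpless. -/
def Helpless (N : ℕ) (g : Bits N → Bool) (c : Fin N → ℝ)
    (price : Fin N → Strategy → ℝ) : Prop :=
  ∀ i : Fin N, ∀ F : Protocol N, ∀ si : Strategy, ¬ ZeroInfo si →
    ∀ sr : Profile N, (∀ j, ZeroInfo (sr j)) →
      U g c price sr F i ≥ U g c price (Function.update sr i si) (improve i F) i

/-- Relative price `price_i^r(s_i) = price_i(s_i) / price_i(sᵗ)`. -/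
def priceR {N : ℕ} (price : Fin N → Strategy → ℝ) (i : Fin N) (s : Strategy) : ℝ :=
  price i s / price i sT

/-- The competitive protocol (the component `F_i^c` for agent `i`). -/
def Fc {N : ℕ} (price : Fin N → Strategy → ℝ) (i : Fin N) : Protocol N := fun s m =>
  if ∀ j, s j = sT then PMF.pure m
  else if ∀ j, j ≠ i → priceR price j (s j) < priceR price i (s i) then PMF.pure m
  else PMF.uniformOfFintype (Bits N)

/-- The protocol that always replies the full message vector `m = (b₀, m₁, …, m_N)`. -/
def Fmax (N : ℕ) : Protocol N := fun _ m => PMF.pure m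

/-- The protocol that always replies `N+1` independent uniform random bits. -/
def Fmin (N : ℕ) : Protocol N := fun _ _ => PMF.uniformOfFintype (Bits N)

/-- Agent `i` is fanatic. -/
def Fanatic {N : ℕ} (g : Bits N → Bool) (c : Fin N → ℝ) (price : Fin N → Strategy → ℝ)
    (i : Fin N) : Prop :=
  ∀ s : Profile N,
    price i sT > V g c (truthProfile N) (Fmax N) i - V g c s (Fmin N) i

/-- The fair competitive protocol (the component `F_i^{fc}` for agent `i`). -/
def Ffc {N : ℕ} (price : Fin N → Strategy → ℝ) (i : Fin N) : Protocol N := fun s m =>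
  if s i = sT then PMF.pure m
  else if (∃ j, j ≠ i ∧ s j ≠ sT) ∧
      (∀ j, j ≠ i → s j ≠ sT → priceR price j (s j) < priceR price i (s i)) then PMF.pure m
  else PMF.uniformOfFintype (Bits N)

/-- A message strategy is a probability distribution over messages. -/
lemma strandP_nonneg (s : Strategy) (x y : Bool) : 0 ≤ strandP s x y := by
  obtain ⟨⟨p, hp0, hp1⟩, ⟨q, hq0, hq1⟩⟩ := s
  cases x <;> cases y <;> simp [strandP] <;> assumption

lemma sum_strandP (s : Strategy) (x : Bool) : ∑ y : Bool, strandP s x y = 1 := by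
  simp [strandP]

/-- The marginal law of agent `i`'s message given the bits. -/
lemma sum_msgP {N : ℕ} (s : Profile N) (b : Bits N) (i : Fin N) (mi : Bool) :
    (∑ m : Bits N, if m i.succ = mi then msgP s b m else 0) =
      strandP (s i) (b i.succ) mi := by
  let h : Fin (N + 1) → Bool → ℝ :=
    Fin.cases (fun x => if x = b 0 then 1 else 0)
      (fun j x => if j = i ∧ x ≠ mi then 0 else strandP (s j) (b j.succ) x)
  have hprod (m : Bits N) :
      (if m i.succ = mi then msgP s b m else 0) = ∏ k, h k (m k) := by
    rw [Fin.prod_univ_succ]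
    simp only [h, Fin.cases_zero, Fin.cases_succ, msgP]
    split_ifs with hm h0 h0
    · congr 1
      refine Finset.prod_congr rfl fun j _ => ?_
      rw [if_neg]
      rintro ⟨rfl, hj⟩
      exact hj hm
    · simp
    · rw [Finset.prod_eq_zero (Finset.mem_univ i) (by simp [hm]), mul_zero]
    · simp
  simp_rw [hprod]
  rw [← Fintype.piFinset_univ, ← Finset.prod_univ_sum, Fin.prod_univ_succ]
  simp only [h, Fin.cases_zero, Fin.cases_succ]
  rw [Finset.prod_eq_single i]
  · simp [ite_not]
  · intro j _ hj
    simp [hj, sum_strandP, -Fintype.univ_bool]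
  · simp

/-- Under random replies, an observation of agent `i` carries no information beyond `bᵢ`. -/
lemma pObs_Fmin {N : ℕ} (g : Bits N → Bool) (s : Profile N) (i : Fin N)
    (bi mi : Bool) (f : Bits N) (val : Bool) :
    pObs g s (Fmin N) i bi mi f val =
      strandP (s i) bi mi * ∑ b : Bits N, if b i.succ = bi ∧ g b = val then
        ((1 : ℝ) / 2) ^ (N + 1) * (PMF.uniformOfFintype (Bits N) f).toReal else 0 := by
  rw [pObs, Finset.mul_sum]
  refine Finset.sum_congr rfl fun b _ => ?_
  by_cases hb : b i.succ = bi ∧ g b = val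
  · rw [if_pos hb, ← hb.1, ← sum_msgP s b i mi, Finset.sum_mul]
    refine Finset.sum_congr rfl fun m _ => ?_
    simp only [hb.2, true_and, and_true, jointP, Fmin]
    split_ifs <;> ring
  · rw [if_neg hb, mul_zero]
    refine Finset.sum_eq_zero fun m _ => if_neg ?_
    tauto

/-- Guessing the more likely value, with ties broken at random, succeeds with the larger of
the two probabilities. -/
lemma guess_eq_max (x y : ℝ) :
    (if x > y then x else if y > x then y else (y + x) / 2) = max x y := by
  split_ifs with h h'
  · exact (max_eq_left h.le).symm
  · exact (max_eq_right h'.le).symm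
  · obtain rfl : x = y := le_antisymm (not_lt.1 h) (not_lt.1 h')
    simp

lemma V_Fmin_eq {N : ℕ} (g : Bits N → Bool) (c : Fin N → ℝ) (s s' : Profile N) (i : Fin N) :
    V g c s (Fmin N) i = V g c s' (Fmin N) i := by
  have key (s : Profile N) (bi : Bool) (A : Bits N → ℝ) :
      ∑ mi : Bool, ∑ f : Bits N, strandP (s i) bi mi * A f = ∑ f, A f := by
    simp_rw [← Finset.mul_sum]
    rw [← Finset.sum_mul, sum_strandP, one_mul]
  simp only [V, guess_eq_max, pObs_Fmin, ← mul_max_of_nonneg _ _ (strandP_nonneg _ _ _), key]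

/-- The profit depends on the protocol only through its behaviour at the played profile. -/
lemma V_congr {N : ℕ} (g : Bits N → Bool) (c : Fin N → ℝ) {s : Profile N} {F F' : Protocol N}
    (h : F s = F' s) (i : Fin N) : V g c s F i = V g c s F' i := by
  have hobs (bi mi : Bool) (f : Bits N) (val : Bool) :
      pObs g s F i bi mi f val = pObs g s F' i bi mi f val := by
    simp only [pObs, jointP, h]
  simp only [V, guess_eq_max, hobs]

lemma not_zeroInfo_sT : ¬ ZeroInfo sT := by
  simp [ZeroInfo, sT]

lemma Fc_truthProfile {N : ℕ} (price : Fin N → Strategy → ℝ) (i : Fin N) :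
    Fc price i (truthProfile N) = Fmax N (truthProfile N) := by
  funext m
  simp [Fc, Fmax, truthProfile]

/-- A unilateral deviation from truthfulness does not win the competition. -/
lemma Fc_deviation {N : ℕ} (hN : 2 ≤ N) {price : Fin N → Strategy → ℝ}
    (hpos : ∀ i, 0 < price i sT) (hmax : ∀ i s, price i s ≤ price i sT)
    (i : Fin N) {s' : Strategy} (hs' : s' ≠ sT) :
    Fc price i (Function.update (truthProfile N) i s') =
      Fmin N (Function.update (truthProfile N) i s') := by
  funext m
  have : Nontrivial (Fin N) := Fin.nontrivial_iff_two_le.2 hN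
  obtain ⟨j, hj⟩ := exists_ne i
  rw [Fc, if_neg, if_neg, Fmin]
  · intro h
    have h := h j hj
    rw [Function.update_of_ne hj, Function.update_self, truthProfile, priceR, priceR,
      div_self (hpos j).ne'] at h
    exact h.not_ge (div_le_one_of_le₀ (hmax i s') (hpos i).le)
  · intro h
    exact hs' (by simpa using h i)

/-- Existence: truthfulness is an equilibrium of the competitive protocol
iff no agent is fanatic. -/
theorem truthful_Fc_iff_no_fanatic (N : ℕ) (hN : 2 ≤ N) (g : Bits N → Bool) (c : Fin N → ℝ)
    (hc : ∀ i, 0 < c i)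
    (price : Fin N → Strategy → ℝ)
    (hpriceCont : ∀ i, Continuous (price i))
    (hprice0 : ∀ i s, ZeroInfo s → price i s = 0)
    (hpricePos : ∀ i s, ¬ ZeroInfo s → 0 < price i s)
    (hpriceMax : ∀ i s, price i s ≤ price i sT) :
    Equilibrium g c price (truthProfile N) (Fc price) ↔
      ∀ i : Fin N, ¬ Fanatic g c price i := by
  have hpos (i : Fin N) : 0 < price i sT := hpricePos i sT not_zeroInfo_sT
  have hdev (i : Fin N) (s' : Strategy) (hs' : s' ≠ sT) (s : Profile N) :
      U g c price (Function.update (truthProfile N) i s') (Fc price i) i =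
        V g c s (Fmin N) i - price i s' := by
    rw [U, V_congr g c (Fc_deviation hN hpos hpriceMax i hs') i, Function.update_self,
      V_Fmin_eq g c _ s]
  have htruth (i : Fin N) : U g c price (truthProfile N) (Fc price i) i =
      V g c (truthProfile N) (Fmax N) i - price i sT := by
    rw [U, V_congr g c (Fc_truthProfile price i) i, truthProfile]
  constructor
  · intro h i hf
    have hzero : ZeroInfo (0, 0) := rfl
    have h := h i (0, 0)
    rw [htruth, hdev i _ (fun e => not_zeroInfo_sT (e ▸ hzero)) (truthProfile N),
      hprice0 i _ hzero] at h
    linarith [hf (truthProfile N)]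
  · intro h i s'
    obtain rfl | hs' := eq_or_ne s' sT
    · rw [show Function.update (truthProfile N) i sT = truthProfile N from
        Function.update_eq_self i (truthProfile N)]
    · obtain ⟨s, hs⟩ := not_forall.1 (h i)
      rw [htruth, hdev i s' hs' s]
      have hnonneg : 0 ≤ price i s' := by
        by_cases hz : ZeroInfo s'
        · exact (hprice0 i s' hz).ge
        · exact (hpricePos i s' hz).le
      linarith

end
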